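/- Consider the gradient flow ẋ(t) = −∇φ_{μ(t)}(x(t)) for t ≥ t0 > 0, where μ : [t0,∞) → (0,∞) is continuously differentiable and nonincreasing and x : [t0,∞) → H is a continuously differentiable solution. Set d0 := dist(x(t0), argmin φ). Then for all t > t0, −C·μ(t) ≤ φ_{μ(t)}(x(t)) − inf φ ≤ d0²/(2(t−t0)) + (C/(t−t0)) ∫_{t0}^t μ(s) ds; consequently, if in addition μ ∈ L¹(t0,∞), then there is a constant K > 0 with |φ_{μ(t)}(x(t)) − inf φ| ≤ K/t for all t large enough. -/

import Mathlib

open scoped BigOperators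
open Set Filter MeasureTheory

/-- The supremum function `φ(x) = max_{λ ∈ Q} ∑ i, λ_i g_i(x)`. -/
noncomputable def phi {H : Type*} (m : ℕ) (g : Fin m → H → ℝ)
    (Q : Set (EuclideanSpace ℝ (Fin m))) (x : H) : ℝ :=
  sSup ((fun l : EuclideanSpace ℝ (Fin m) => ∑ i, l i * g i x) '' Q)

/-- The regularized function `φ_μ(x) = max_{λ ∈ Q} ( ∑ i, λ_i g_i(x) - μ D(λ) )`. -/
noncomputable def phiMu {H : Type*} (m : ℕ) (g : Fin m → H → ℝ)
    (Q : Set (EuclideanSpace ℝ (Fin m))) (D : EuclideanSpace ℝ (Fin m) → ℝ)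
    (μ : ℝ) (x : H) : ℝ :=
  sSup ((fun l : EuclideanSpace ℝ (Fin m) => ∑ i, l i * g i x - μ * D l) '' Q)

theorem aux_convex_grad {H : Type*} [NormedAddCommGroup H] [InnerProductSpace ℝ H]
    [CompleteSpace H] (f : H → ℝ) (hf : ConvexOn ℝ Set.univ f) (hd : Differentiable ℝ f)
    (x y : H) : f x + inner ℝ (gradient f x) (y - x) ≤ f y := by
  have h1 : ConvexOn ℝ Set.univ (fun s : ℝ => f (AffineMap.lineMap x y s)) := by
    exact hf.comp_affineMap (AffineMap.lineMap x y : ℝ →ᵃ[ℝ] H)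
  have h2 : HasDerivAt (fun s : ℝ => f (AffineMap.lineMap x y s))
      (inner ℝ (gradient f x) (y - x)) 0 := by
    have hg : HasFDerivAt f (InnerProductSpace.toDual ℝ H (gradient f x))
        (AffineMap.lineMap x y (0 : ℝ)) := by
      have := (hd x).hasGradientAt.hasFDerivAt
      simpa using this
    have := hg.comp_hasDerivAt (0 : ℝ) (AffineMap.hasDerivAt_lineMap (a := x) (b := y) (x := (0:ℝ)))
    exact this
  have h3 := h1.le_slope_of_hasDerivAt (Set.mem_univ (0:ℝ)) (Set.mem_univ (1:ℝ)) one_pos h2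
  rw [slope_def_field, AffineMap.lineMap_apply_one, AffineMap.lineMap_apply_zero] at h3
  linarith

theorem aux_exists_max {H : Type*} (m : ℕ) (g : Fin m → H → ℝ)
    (Q : Set (EuclideanSpace ℝ (Fin m))) (hQne : Q.Nonempty) (hQcomp : IsCompact Q)
    (D : EuclideanSpace ℝ (Fin m) → ℝ) (hDcont : Continuous D) (μ : ℝ) (x : H) :
    ∃ l ∈ Q, phiMu m g Q D μ x = ∑ i, l i * g i x - μ * D l := by
  obtain ⟨l, hl, h, -⟩ := hQcomp.exists_sSup_image_eq_and_ge hQne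
    (f := fun l : EuclideanSpace ℝ (Fin m) => ∑ i, l i * g i x - μ * D l)
    (by fun_prop)
  exact ⟨l, hl, h⟩

theorem aux_le_max {H : Type*} (m : ℕ) (g : Fin m → H → ℝ)
    (Q : Set (EuclideanSpace ℝ (Fin m))) (hQcomp : IsCompact Q)
    (D : EuclideanSpace ℝ (Fin m) → ℝ) (hDcont : Continuous D) (μ : ℝ) (x : H)
    (l) (hl : l ∈ Q) :
    ∑ i, l i * g i x - μ * D l ≤ phiMu m g Q D μ x := by
  refine le_csSup ?_ ⟨l, hl, rfl⟩
  exact (hQcomp.image (by fun_prop)).bddAbove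

theorem aux_phi {H : Type*} (m : ℕ) (g : Fin m → H → ℝ)
    (Q : Set (EuclideanSpace ℝ (Fin m))) 
    (D : EuclideanSpace ℝ (Fin m) → ℝ) (x : H) :
    phi m g Q x = phiMu m g Q D 0 x := by
  simp [phi, phiMu]

/-- comparing two parameters -/
theorem aux_param {H : Type*} (m : ℕ) (g : Fin m → H → ℝ)
    (Q : Set (EuclideanSpace ℝ (Fin m))) (hQne : Q.Nonempty) (hQcomp : IsCompact Q)
    (D : EuclideanSpace ℝ (Fin m) → ℝ) (hDcont : Continuous D)
    (hDnonneg : ∀ l ∈ Q, 0 ≤ D l) (C : ℝ) (hC : IsLUB (D '' Q) C) (a b : ℝ) (hab : a ≤ b) (x : H) :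
    phiMu m g Q D b x ≤ phiMu m g Q D a x ∧
    phiMu m g Q D a x ≤ phiMu m g Q D b x + C * (b - a) := by
  constructor
  · obtain ⟨l, hl, h⟩ := aux_exists_max m g Q hQne hQcomp D hDcont b x
    have := aux_le_max m g Q hQcomp D hDcont a x l hl
    nlinarith [hDnonneg l hl]
  · obtain ⟨l, hl, h⟩ := aux_exists_max m g Q hQne hQcomp D hDcont a x
    have := aux_le_max m g Q hQcomp D hDcont b x l hl
    have hc : D l ≤ C := hC.1 ⟨l, hl, rfl⟩
    nlinarith

theorem aux_cont {H : Type*} [TopologicalSpace H] (m : ℕ) (g : Fin m → H → ℝ)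
    (hg : ∀ i, Continuous (g i))
    (Q : Set (EuclideanSpace ℝ (Fin m))) (hQcomp : IsCompact Q)
    (D : EuclideanSpace ℝ (Fin m) → ℝ) (hDcont : Continuous D) :
    Continuous (fun p : ℝ × H => phiMu m g Q D p.1 p.2) := by
  refine hQcomp.continuous_sSup
    (f := fun (p : ℝ × H) (l : EuclideanSpace ℝ (Fin m)) => ∑ i, l i * g i p.2 - p.1 * D l) ?_
  unfold Function.HasUncurry.uncurry
  simp only [Function.hasUncurryInduction, Function.hasUncurryBase, id]
  fun_prop

/-- strong concavity estimate -/
theorem aux_strong {H : Type*} (m : ℕ) (g : Fin m → H → ℝ)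
    (Q : Set (EuclideanSpace ℝ (Fin m))) (hQcomp : IsCompact Q)
    (D : EuclideanSpace ℝ (Fin m) → ℝ) (hDcont : Continuous D)
    (σ : ℝ) (hDsc : StrongConvexOn Q σ D) (μ : ℝ) (hμ : 0 < μ) (x y : H)
    (l k) (hl : l ∈ Q) (hk : k ∈ Q)
    (hlx : phiMu m g Q D μ x = ∑ i, l i * g i x - μ * D l)
    (hky : phiMu m g Q D μ y = ∑ i, k i * g i y - μ * D k) :
    μ * σ / 4 * ‖k - l‖ ^ 2 ≤ ‖k - l‖ * ∑ i, |g i y - g i x| := by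
  obtain ⟨hcv, hsc⟩ := hDsc
  have h1 := hsc hl hk (show (0:ℝ) ≤ 1/2 by norm_num) (show (0:ℝ) ≤ 1/2 by norm_num) (by norm_num)
  have hmid := hcv hl hk (show (0:ℝ) ≤ 1/2 by norm_num) (show (0:ℝ) ≤ 1/2 by norm_num) (by norm_num)
  have h2 := aux_le_max m g Q hQcomp D hDcont μ x _ hmid
  have h3 := aux_le_max m g Q hQcomp D hDcont μ y l hl
  have e : ∑ i, ((1/2 : ℝ) • l + (1/2 : ℝ) • k) i * g i x
      = 1/2 * ∑ i, l i * g i x + 1/2 * ∑ i, k i * g i x := by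
    simp only [Finset.mul_sum, ← Finset.sum_add_distrib]
    refine Finset.sum_congr rfl fun i _ => ?_
    simp; ring
  have e2 : ∑ i, (k i - l i) * (g i y - g i x) ≤ ‖k - l‖ * ∑ i, |g i y - g i x| := by
    rw [Finset.mul_sum]
    refine Finset.sum_le_sum fun i _ => ?_
    have := PiLp.norm_apply_le (k - l) i
    simp only [PiLp.sub_apply, Real.norm_eq_abs] at this
    calc _ ≤ |(k i - l i) * (g i y - g i x)| := le_abs_self _
      _ = |k i - l i| * |g i y - g i x| := abs_mul _ _
      _ ≤ _ := mul_le_mul_of_nonneg_right this (abs_nonneg _)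
  have e3 : ∑ i, (k i - l i) * (g i y - g i x) =
      ∑ i, k i * g i y - ∑ i, k i * g i x - ∑ i, l i * g i y + ∑ i, l i * g i x := by
    simp only [← Finset.sum_sub_distrib, ← Finset.sum_add_distrib]
    refine Finset.sum_congr rfl fun i _ => ?_
    ring
  rw [e] at h2
  simp only [smul_eq_mul] at h1
  have h1' := mul_le_mul_of_nonneg_left h1 hμ.le
  rw [norm_sub_rev l k] at h1'
  nlinarith

theorem aux_sub {H : Type*} [NormedAddCommGroup H] [InnerProductSpace ℝ H]
    [CompleteSpace H] (m : ℕ) 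
    (g : Fin m → H → ℝ) (hg : ∀ i, ConvexOn ℝ Set.univ (g i))
    (hgdiff : ∀ i, Differentiable ℝ (g i))
    (Q : Set (EuclideanSpace ℝ (Fin m))) (hQcomp : IsCompact Q)
    (hQpos : ∀ l ∈ Q, ∀ i, 0 ≤ l i)
    (D : EuclideanSpace ℝ (Fin m) → ℝ) (hDcont : Continuous D)
    (μ : ℝ) (x y : H) (l) (hl : l ∈ Q)
    (hlx : phiMu m g Q D μ x = ∑ i, l i * g i x - μ * D l) :
    phiMu m g Q D μ x + inner ℝ (∑ i, l i • gradient (g i) x) (y - x) ≤ phiMu m g Q D μ y := by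
  refine le_trans ?_ (aux_le_max m g Q hQcomp D hDcont μ y l hl)
  have : ∑ i, (l i * g i x + l i * inner ℝ (gradient (g i) x) (y - x)) ≤ ∑ i, l i * g i y := by
    refine Finset.sum_le_sum fun i _ => ?_
    rw [← mul_add]
    exact mul_le_mul_of_nonneg_left (aux_convex_grad _ (hg i) (hgdiff i) x y) (hQpos l hl i)
  rw [Finset.sum_add_distrib] at this
  rw [sum_inner]
  simp only [real_inner_smul_left]
  linarith

theorem aux_grad {H : Type*} [NormedAddCommGroup H] [InnerProductSpace ℝ H]
    [CompleteSpace H] (m : ℕ) 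
    (g : Fin m → H → ℝ) (hg : ∀ i, ConvexOn ℝ Set.univ (g i))
    (hgdiff : ∀ i, Differentiable ℝ (g i))
    (hgc : ∀ i, Continuous (gradient (g i)))
    (Q : Set (EuclideanSpace ℝ (Fin m))) (hQne : Q.Nonempty) (hQcomp : IsCompact Q)
    (hQpos : ∀ l ∈ Q, ∀ i, 0 ≤ l i)
    (D : EuclideanSpace ℝ (Fin m) → ℝ) (hDcont : Continuous D)
    (σ : ℝ) (hσ : 0 < σ) (hDsc : StrongConvexOn Q σ D)
    (μ : ℝ) (hμ : 0 < μ) (x z : H) :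
    phiMu m g Q D μ x + inner ℝ (gradient (phiMu m g Q D μ) x) (z - x) ≤ phiMu m g Q D μ z := by
  choose L hLQ hL using fun y => aux_exists_max m g Q hQne hQcomp D hDcont μ y
  have hsub : ∀ y w, _ := fun y w =>
    aux_sub m g hg hgdiff Q hQcomp hQpos D hDcont μ y w (L y) (hLQ y) (hL y)
  have hLc : Tendsto (fun y => L y - L x) (nhds x) (nhds 0) := by
    have hb : ∀ y, ‖L y - L x‖ ≤ (∑ i, |g i y - g i x|) / (μ * σ / 4) := by
      intro y
      have h := aux_strong m g Q hQcomp D hDcont σ hDsc μ hμ x y _ _ (hLQ x) (hLQ y) (hL x) (hL y)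
      have hc : 0 < μ * σ / 4 := by positivity
      rw [le_div_iff₀ hc]
      rcases (norm_nonneg (L y - L x)).eq_or_lt with h0 | h0
      · rw [← h0, zero_mul]; exact Finset.sum_nonneg fun i _ => abs_nonneg _
      · have : ‖L y - L x‖ * (‖L y - L x‖ * (μ * σ / 4)) ≤ ‖L y - L x‖ * ∑ i, |g i y - g i x| := by
          nlinarith
        exact le_of_mul_le_mul_left this h0
    refine squeeze_zero_norm hb ?_
    have hcont : Continuous (fun y => (∑ i, |g i y - g i x|) / (μ * σ / 4)) := by
      have := fun i => (hgdiff i).continuous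
      fun_prop
    simpa using hcont.tendsto x
  have hLc' : ContinuousAt L x := by
    have := hLc.add_const (L x)
    simpa [ContinuousAt] using this
  have hv : ContinuousAt (fun y => ∑ i, L y i • gradient (g i) y) x := by
    have h2 : ∀ i, ContinuousAt (fun y => L y i) x := fun i =>
      ((EuclideanSpace.proj (𝕜 := ℝ) i).continuous.continuousAt (x := L x)).comp hLc'
    exact tendsto_finsetSum _ fun i _ => (h2 i).smul (hgc i).continuousAt
  have hG : HasGradientAt (phiMu m g Q D μ) (∑ i, L x i • gradient (g i) x) x := by
    rw [hasGradientAt_iff_isLittleO]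
    rw [Asymptotics.isLittleO_iff]
    intro c hc
    have := Metric.continuousAt_iff'.1 hv c hc
    filter_upwards [this] with y hy
    have h1 := hsub x y
    have h2 := hsub y x
    rw [dist_eq_norm] at hy
    have h3 := real_inner_le_norm
      ((∑ i, L y i • gradient (g i) y) - ∑ i, L x i • gradient (g i) x) (y - x)
    rw [inner_sub_left] at h3
    rw [← neg_sub y x, inner_neg_right] at h2
    rw [Real.norm_eq_abs, abs_le]
    have h4 := mul_le_mul_of_nonneg_right hy.le (norm_nonneg (y - x))
    have h5 := mul_nonneg hc.le (norm_nonneg (y - x))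
    constructor <;> linarith
  rw [hG.gradient]
  exact hsub x z

theorem statement19 {H : Type*} [NormedAddCommGroup H] [InnerProductSpace ℝ H]
    [CompleteSpace H]
    (m : ℕ) (hm : 1 ≤ m)
    (g : Fin m → H → ℝ) (hg : ∀ i, ConvexOn ℝ Set.univ (g i))
    (hgdiff : ∀ i, Differentiable ℝ (g i))
    -- each `∇ g i` is Lipschitz continuous on every bounded set
    (hgradLip : ∀ i, ∀ s : Set H, Bornology.IsBounded s →
      ∃ Li : ℝ, ∀ x ∈ s, ∀ y ∈ s,
        ‖gradient (g i) x - gradient (g i) y‖ ≤ Li * ‖x - y‖)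
    (Q : Set (EuclideanSpace ℝ (Fin m))) (hQne : Q.Nonempty) (hQcomp : IsCompact Q)
    (hQconv : Convex ℝ Q) (hQpos : ∀ l ∈ Q, ∀ i, 0 ≤ l i)
    (D : EuclideanSpace ℝ (Fin m) → ℝ) (hDcont : Continuous D)
    (hDnonneg : ∀ l ∈ Q, 0 ≤ D l)
    (σ : ℝ) (hσ : 0 < σ) (hDsc : StrongConvexOn Q σ D)
    (hDinf : IsGLB (D '' Q) 0)
    (C : ℝ) (hC : IsLUB (D '' Q) C)
    -- `D` is differentiable on a neighborhood `U` of `Q`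
    (U : Set (EuclideanSpace ℝ (Fin m))) (hUopen : IsOpen U) (hQU : Q ⊆ U)
    (hDdiff : ∀ l ∈ U, DifferentiableAt ℝ D l)
    -- `argmin φ ≠ ∅`
    (hargmin : ∃ xs : H, ∀ y : H, phi m g Q xs ≤ phi m g Q y)
    -- `inf φ` is attained at `xstar`
    (xstar : H) (hstar : ∀ y : H, phi m g Q xstar ≤ phi m g Q y)
    -- time data
    (t0 : ℝ) (ht0 : 0 < t0)
    -- `μ` is continuously differentiable, positive and nonincreasing on `[t0, ∞)`
    (μ μ' : ℝ → ℝ) (hμpos : ∀ t ∈ Set.Ici t0, 0 < μ t)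
    (hμderiv : ∀ t ∈ Set.Ici t0, HasDerivAt μ (μ' t) t)
    (hμ'cont : ContinuousOn μ' (Set.Ici t0))
    (hμanti : AntitoneOn μ (Set.Ici t0))
    -- `x` is a continuously differentiable solution of the gradient flow
    (x x' : ℝ → H)
    (hx' : ∀ t ∈ Set.Ici t0, HasDerivAt x (x' t) t)
    (hx'cont : ContinuousOn x' (Set.Ici t0))
    (hODE : ∀ t ∈ Set.Ici t0, x' t = -gradient (phiMu m g Q D (μ t)) (x t))
    -- `d0` is the distance from `x(t0)` to `argmin φ`
    (d0 : ℝ)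
    (hd0 : d0 = Metric.infDist (x t0) {z : H | ∀ y : H, phi m g Q z ≤ phi m g Q y}) :
    (∀ t > t0,
      -C * μ t ≤ phiMu m g Q D (μ t) (x t) - phi m g Q xstar ∧
      phiMu m g Q D (μ t) (x t) - phi m g Q xstar ≤
        d0 ^ 2 / (2 * (t - t0)) + (C / (t - t0)) * ∫ s in t0..t, μ s) ∧
    (MeasureTheory.IntegrableOn μ (Set.Ioi t0) →
      ∃ K : ℝ, 0 < K ∧ ∃ T : ℝ, ∀ t ≥ T,
        |phiMu m g Q D (μ t) (x t) - phi m g Q xstar| ≤ K / t) := by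
  have hC0 : 0 ≤ C := by
    obtain ⟨l, hl⟩ := hQne
    exact (hDnonneg l hl).trans (hC.1 ⟨l, hl, rfl⟩)
  have hgc : ∀ i, Continuous (gradient (g i)) := by
    intro i
    rw [continuous_iff_continuousAt]
    intro x
    obtain ⟨L, hL⟩ := hgradLip i (Metric.ball x 1) Metric.isBounded_ball
    have hx : x ∈ Metric.ball x 1 := Metric.mem_ball_self one_pos
    rw [ContinuousAt, tendsto_iff_norm_sub_tendsto_zero]
    refine squeeze_zero' (.of_forall fun _ => norm_nonneg _)
      (g := fun y => L * ‖y - x‖) ?_ ?_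
    · filter_upwards [Metric.ball_mem_nhds x one_pos] with y hy
      exact hL y hy x hx
    · have : Continuous (fun y => L * ‖y - x‖) := by fun_prop
      simpa using this.tendsto x
  have hgrad := fun a (ha : 0 < a) => aux_grad m g hg hgdiff hgc Q hQne hQcomp hQpos D hDcont σ hσ
    hDsc a ha
  have hpar := aux_param m g Q hQne hQcomp D hDcont hDnonneg C hC
  have hcont := aux_cont m g (fun i => (hgdiff i).continuous) Q hQcomp D hDcont
  have hxc : ContinuousOn x (Ici t0) := fun t ht => (hx' t ht).continuousAt.continuousWithinAt
  have hμc : ContinuousOn μ (Ici t0) := fun t ht => (hμderiv t ht).continuousAt.continuousWithinAt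
  set G : ℝ → ℝ := fun t => phiMu m g Q D (μ t) (x t) + C * μ t with hG
  have hGc : ContinuousOn G (Ici t0) :=
    (hcont.comp_continuousOn (hμc.prodMk hxc)).add (hμc.const_smul C)
  have hGstep : ∀ s t, t0 ≤ s → s ≤ t → G t - G s ≤ - inner ℝ (x' t) (x t - x s) := by
    intro s t hs hst
    have ht : t ∈ Ici t0 := hs.trans hst
    have h1 := hgrad (μ t) (hμpos t ht) (x t) (x s)
    have h2 := (hpar (μ t) (μ s) (hμanti hs ht hst) (x s)).2
    rw [hODE t ht, inner_neg_left, neg_neg]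
    rw [← neg_sub (x t) (x s), inner_neg_right] at h1
    simp only [hG]
    linarith
  have hGanti : ∀ s t, t0 ≤ s → s ≤ t → G t ≤ G s := by
    intro s t hs hst
    refine image_le_of_liminf_slope_right_le_deriv_boundary (f := G) (B := fun _ => G s)
      (B' := fun _ => 0) (hGc.mono fun u hu => hs.trans hu.1) le_rfl continuousOn_const
      (fun u _ => hasDerivWithinAt_const _ _ _) ?_ ⟨hst, le_rfl⟩
    intro u hu r hr
    have hu0 : t0 ≤ u := hs.trans hu.1
    apply Filter.Eventually.frequently
    have h1 : Tendsto (slope x u) (nhdsWithin u (Ioi u)) (nhds (x' u)) :=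
      (hasDerivAt_iff_tendsto_slope.1 (hx' u hu0)).mono_left
        (nhdsWithin_mono _ fun v (hv : u < v) => hv.ne')
    have h2 : Tendsto x' (nhdsWithin u (Ioi u)) (nhds (x' u)) :=
      (hx'cont u hu0).mono_left (nhdsWithin_mono _ fun v (hv : u < v) => hu0.trans hv.le)
    have h3 := (h2.inner (𝕜 := ℝ) h1).neg
    have h4 : -inner ℝ (x' u) (x' u) < r := by
      have := real_inner_self_nonneg (x := x' u)
      linarith
    filter_upwards [h3.eventually_lt_const h4, self_mem_nhdsWithin] with v hv huv
    have huv : u < v := huv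
    refine lt_of_le_of_lt ?_ hv
    have := hGstep u v hu0 huv.le
    rw [slope_def_field, slope_def_module, inner_smul_right, div_eq_inv_mul, ← mul_neg]
    exact mul_le_mul_of_nonneg_left this (inv_nonneg.2 (by linarith))
  have hlow : ∀ t ≥ t0, -C * μ t ≤ phiMu m g Q D (μ t) (x t) - phi m g Q xstar := by
    intro t ht
    have h1 := (hpar 0 (μ t) (hμpos t ht).le (x t)).2
    rw [← aux_phi] at h1
    have := hstar (x t)
    linarith
  have hkey : ∀ t > t0, ∀ z, (∀ y, phi m g Q z ≤ phi m g Q y) →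
      (t - t0) * (G t - phi m g Q xstar) ≤ ‖x t0 - z‖ ^ 2 / 2 + C * ∫ s in t0..t, μ s := by
    intro t ht z hz
    set ν : ℝ → ℝ := fun s => μ (max t0 s) with hν
    have hνc : Continuous ν :=
      hμc.comp_continuous (by fun_prop) (fun s => mem_Ici.2 (le_max_left _ _))
    have hint : ∫ s in t0..t, μ s = ∫ s in t0..t, ν s := by
      refine intervalIntegral.integral_congr fun s hs => ?_
      rw [uIcc_of_le ht.le] at hs
      simp [hν, max_eq_right hs.1]
    have hd : ∀ s ∈ Icc t0 t, HasDerivAt (fun s => ‖x s - z‖ ^ 2 / 2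
        + (s - t0) * (G t - phi m g Q xstar) - C * ∫ r in t0..s, ν r)
        (2 * inner ℝ (x s - z) (x' s) / 2 + 1 * (G t - phi m g Q xstar) - C * ν s) s := by
      intro s hs
      refine HasDerivAt.sub (HasDerivAt.add ?_ ?_) ?_
      · exact (((hx' s hs.1).sub_const z).norm_sq).div_const 2
      · exact ((hasDerivAt_id s).sub_const t0).mul_const _
      · exact (hνc.integral_hasStrictDerivAt t0 s).hasDerivAt.const_mul C
    have hanti := antitoneOn_of_deriv_nonpos (convex_Icc t0 t)
      (fun s hs => (hd s hs).continuousAt.continuousWithinAt)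
      (fun s hs => (hd s (interior_subset hs)).differentiableAt.differentiableWithinAt)
      (by
        intro s hs
        have hs := interior_subset hs
        rw [(hd s hs).deriv]
        have h1 := hgrad (μ s) (hμpos s hs.1) (x s) z
        have h2 := (hpar 0 (μ s) (hμpos s hs.1).le z).1
        rw [← aux_phi] at h2
        have h3 := hz xstar
        have h4 := hGanti s t hs.1 hs.2
        have h5 : ν s = μ s := by simp [hν, max_eq_right hs.1]
        rw [h5, hODE s hs.1, inner_neg_right, real_inner_comm]
        rw [← neg_sub (x s) z, inner_neg_right] at h1
        have h6 : G s = phiMu m g Q D (μ s) (x s) + C * μ s := rfl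
        linarith)
    have := hanti (left_mem_Icc.2 ht.le) (right_mem_Icc.2 ht.le) ht.le
    simp only [intervalIntegral.integral_same, sub_self, zero_mul, mul_zero, add_zero,
      sub_zero] at this
    rw [hint]
    have := sq_nonneg ‖x t - z‖
    linarith
  have hkey2 : ∀ t > t0, 
      (t - t0) * (G t - phi m g Q xstar) ≤ d0 ^ 2 / 2 + C * ∫ s in t0..t, μ s := by
    intro t ht
    set A := (t - t0) * (G t - phi m g Q xstar) - C * ∫ s in t0..t, μ s with hA
    have h1 : √(2 * A) ≤ d0 := by
      rw [hd0]
      refine (Metric.le_infDist (s := {z : H | ∀ y : H, phi m g Q z ≤ phi m g Q y}) ⟨xstar, hstar⟩).2 fun {z} hz => ?_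
      rw [dist_eq_norm]
      refine Real.sqrt_le_iff.2 ⟨norm_nonneg _, ?_⟩
      have := hkey t ht z hz
      linarith
    have := (Real.sqrt_le_iff.1 h1).2
    linarith
  have hup : ∀ t > t0, phiMu m g Q D (μ t) (x t) - phi m g Q xstar ≤
        d0 ^ 2 / (2 * (t - t0)) + (C / (t - t0)) * ∫ s in t0..t, μ s := by
    intro t ht
    have htt : 0 < t - t0 := sub_pos.2 ht
    have h := hkey2 t ht
    have h1 : d0 ^ 2 / (2 * (t - t0)) + (C / (t - t0)) * ∫ s in t0..t, μ s
      = (d0 ^ 2 / 2 + C * ∫ s in t0..t, μ s) / (t - t0) := by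
      field_simp
    rw [h1, le_div_iff₀ htt]
    have h2 : 0 ≤ C * μ t * (t - t0) :=
      mul_nonneg (mul_nonneg hC0 (hμpos t ht.le).le) htt.le
    have h6 : G t = phiMu m g Q D (μ t) (x t) + C * μ t := rfl
    rw [h6] at h
    linarith
  refine ⟨fun t ht => ⟨hlow t ht.le, hup t ht⟩, fun hi => ?_⟩
  set I := ∫ s in Ioi t0, μ s with hI
  have hI0 : 0 ≤ I := setIntegral_nonneg measurableSet_Ioi fun s hs => (hμpos s (mem_Ici.2 (le_of_lt (mem_Ioi.1 hs)))).le
  have hle : ∀ t > t0, ∫ s in t0..t, μ s ≤ I := by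
    intro t ht
    rw [intervalIntegral.integral_of_le ht.le]
    refine setIntegral_mono_set hi ?_ (HasSubset.Subset.eventuallyLE Ioc_subset_Ioi_self)
    filter_upwards [ae_restrict_mem measurableSet_Ioi] with s hs
    exact (hμpos s (mem_Ici.2 (le_of_lt (mem_Ioi.1 hs)))).le
  have hge : ∀ t > t0, (t - t0) * μ t ≤ ∫ s in t0..t, μ s := by
    intro t ht
    have h1 : ∫ s in t0..t, μ t ≤ ∫ s in t0..t, μ s := by
      refine intervalIntegral.integral_mono_on ht.le (by simp) ?_ ?_
      · refine ContinuousOn.intervalIntegrable ?_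
        rw [uIcc_of_le ht.le]
        exact hμc.mono Icc_subset_Ici_self
      · intro s hs
        exact hμanti hs.1 ht.le hs.2
    simpa using h1
  refine ⟨d0 ^ 2 + 2 * C * I + 1, by positivity, 2 * t0, fun t ht => ?_⟩
  have ht1 : t > t0 := by linarith
  have htt : 0 < t - t0 := sub_pos.2 ht1
  have htpos : 0 < t := by linarith
  have hCI := mul_nonneg hC0 hI0
  have h1 := hlow t ht1.le
  have h2 := hkey2 t ht1
  have h3 := mul_le_mul_of_nonneg_left (hle t ht1) hC0
  have h4 := mul_le_mul_of_nonneg_left ((hge t ht1).trans (hle t ht1)) hC0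
  have h6 : G t = phiMu m g Q D (μ t) (x t) + C * μ t := rfl
  have h7 : 0 ≤ C * μ t := mul_nonneg hC0 (hμpos t ht1.le).le
  have h8 : 0 ≤ G t - phi m g Q xstar := by rw [h6]; linarith
  have h9 : t * (G t - phi m g Q xstar) ≤ d0 ^ 2 + 2 * C * I := by
    nlinarith
  have h10 : t * (C * μ t) ≤ 2 * C * I := by
    nlinarith
  have h11 : 0 ≤ t * (C * μ t) := mul_nonneg htpos.le h7
  rw [le_div_iff₀ htpos, ← abs_of_pos htpos, ← abs_mul, abs_of_pos htpos, abs_le]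
  rw [h6] at h9
  constructor <;> nlinarith [sq_nonneg d0, mul_le_mul_of_nonneg_left h1 htpos.le]
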